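/- Let Ω = ℝ × (−1,1) ⊂ ℝ² be the open strip with boundary ∂Ω = ℝ × {−1, 1}. There exists a smooth compactly supported function η : ℝ² → ℝ such that ∫_{∂Ω} η² > ∫_Ω |∇η|², where the boundary integral is with respect to 1-dimensional length measure on the two lines. -/

import Mathlib

open MeasureTheory Real Set
open scoped RealInnerProductSpace

noncomputable section

abbrev R2 : Type := EuclideanSpace ℝ (Fin 2)

def e (i : Fin 2) : R2 := EuclideanSpace.single i 1

/-- partial derivative in direction `e i` -/
def pd (i : Fin 2) (u : R2 → ℝ) (x : R2) : ℝ := fderiv ℝ u x (e i)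

/-- Euclidean Laplacian on `ℝ²` -/
def lap (u : R2 → ℝ) (x : R2) : ℝ := ∑ i, pd i (pd i u) x

/-- Euclidean gradient on `ℝ²` -/
def grad (u : R2 → ℝ) (x : R2) : R2 := ∑ i, pd i u x • e i

/-- unit circle parametrization -/
def circ (θ : ℝ) : R2 := Real.cos θ • e 0 + Real.sin θ • e 1


/-- integral over the strip of a function of the first coordinate -/
theorem strip_integral (h : ℝ → ℝ) :
    (∫ x in {x : R2 | -1 < x 1 ∧ x 1 < 1}, h (x 0)) = 2 * ∫ t : ℝ, h t := by
  have hm : MeasurePreserving (fun x : R2 => ((x 0, x 1) : ℝ × ℝ)) volume volume :=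
    (volume_preserving_finTwoArrow ℝ).comp (PiLp.volume_preserving_ofLp (Fin 2))
  have he : MeasurableEmbedding (fun x : R2 => ((x 0, x 1) : ℝ × ℝ)) :=
    (MeasurableEquiv.finTwoArrow (α := ℝ)).measurableEmbedding.comp
      (MeasurableEquiv.toLp 2 (Fin 2 → ℝ)).symm.measurableEmbedding
  have h1 := hm.setIntegral_preimage_emb he (fun p : ℝ × ℝ => h p.1 * 1)
    (Set.univ ×ˢ Set.Ioo (-1 : ℝ) 1)
  have h2 : (fun x : R2 => ((x 0, x 1) : ℝ × ℝ)) ⁻¹' (Set.univ ×ˢ Set.Ioo (-1 : ℝ) 1)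
      = {x : R2 | -1 < x 1 ∧ x 1 < 1} := by
    ext x; simp
  rw [h2, Measure.volume_eq_prod,
    setIntegral_prod_mul (μ := (volume : Measure ℝ)) (ν := (volume : Measure ℝ)) h (fun _ => 1)] at h1
  simp only [mul_one] at h1
  rw [h1]
  simp
  ring

theorem grad_eta (f g : ℝ → ℝ) (hf : ContDiff ℝ 1 f) (R : ℝ)
    (x : R2) (hg : g =ᶠ[nhds (x 1)] 1) :
    ‖grad (fun x : R2 => f (x 0 / R) * g (x 1)) x‖ ^ 2 = (deriv f (x 0 / R) / R) ^ 2 := by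
  have hev : (fun x : R2 => f (x 0 / R) * g (x 1)) =ᶠ[nhds x] fun x : R2 => f (x 0 / R) := by
    have hc : Filter.Tendsto (fun y : R2 => y 1) (nhds x) (nhds (x 1)) := by
      have : Continuous (fun y : R2 => y 1) := by fun_prop
      exact this.tendsto x
    filter_upwards [hc.eventually hg] with y hy
    simp [hy]
  have hp : HasFDerivAt (fun y : R2 => y 0 / R)
      (R⁻¹ • (EuclideanSpace.proj 0 : R2 →L[ℝ] ℝ)) x := by
    have := (EuclideanSpace.proj 0 : R2 →L[ℝ] ℝ).hasFDerivAt (x := x)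
    convert! this.const_smul R⁻¹ using 1
    ext y; simp [div_eq_inv_mul]
  have hd : HasFDerivAt (fun x : R2 => f (x 0 / R))
      (deriv f (x 0 / R) • (R⁻¹ • (EuclideanSpace.proj 0 : R2 →L[ℝ] ℝ))) x :=
    ((hf.differentiable (by norm_num)) (x 0 / R)).hasDerivAt.comp_hasFDerivAt x hp
  have hF := (hd.congr_of_eventuallyEq hev).fderiv
  rw [EuclideanSpace.norm_sq_eq]
  simp [grad, pd, hF, e, Fin.sum_univ_two]
  ring

/-- The stability inequality fails on the strip. -/
theorem stmt12 :
    ∃ η : R2 → ℝ, ContDiff ℝ (⊤ : ℕ∞) η ∧ HasCompactSupport η ∧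
      (∫ x in {x : R2 | -1 < x 1 ∧ x 1 < 1}, ‖grad η x‖ ^ 2)
        < (∫ t : ℝ, (η (t • e 0 + (1:ℝ) • e 1)) ^ 2)
          + ∫ t : ℝ, (η (t • e 0 + (-1:ℝ) • e 1)) ^ 2 := by
  let f : ContDiffBump (0 : ℝ) := ⟨1, 2, by norm_num, by norm_num⟩
  let g : ContDiffBump (0 : ℝ) := ⟨2, 3, by norm_num, by norm_num⟩
  have hB : 0 < ∫ t : ℝ, (f t) ^ 2 := by
    apply Continuous.integral_pos_of_hasCompactSupport_nonneg_nonzero (x := 0)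
    · exact f.continuous.pow 2
    · refine f.hasCompactSupport.comp_left (g := fun y : ℝ => y ^ 2) (by simp)
    · intro t; positivity
    · have : f 0 = 1 := f.one_of_mem_closedBall (by simp [f])
      simp [this]
  have hA : 0 ≤ ∫ t : ℝ, (deriv f t) ^ 2 := integral_nonneg fun t => by positivity
  obtain ⟨R, hR1, hR⟩ : ∃ R : ℝ, 0 < R ∧
      (∫ t : ℝ, (deriv f t) ^ 2) < R ^ 2 * ∫ t : ℝ, (f t) ^ 2 := by
    generalize (∫ t : ℝ, (deriv f t) ^ 2) = A at *
    generalize (∫ t : ℝ, (f t) ^ 2) = B at *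
    have h0 : 0 ≤ A / B := by positivity
    refine ⟨A / B + 1, by positivity, ?_⟩
    have h1 : A = A / B * B := by field_simp
    nlinarith [mul_nonneg h0 hB.le, mul_nonneg (mul_nonneg h0 h0) hB.le]
  have hg1 : ∀ y : ℝ, |y| < 2 → (g : ℝ → ℝ) =ᶠ[nhds y] 1 := fun y hy =>
    g.eventuallyEq_one_of_mem_ball (by simpa [g] using hy)
  refine ⟨fun x => f (x 0 / R) * g (x 1), ?_, ?_, ?_⟩
  · have h0 : ContDiff ℝ (⊤ : ℕ∞) (fun x : R2 => x 0 / R) := by fun_prop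
    have h1 : ContDiff ℝ (⊤ : ℕ∞) (fun x : R2 => x 1) := by fun_prop
    exact (f.contDiff.comp h0).mul (g.contDiff.comp h1)
  · refine HasCompactSupport.of_support_subset_isCompact
      (isCompact_closedBall (0 : R2) (2 * R + 3)) ?_
    intro x hx
    have hx' : f (x 0 / R) * g (x 1) ≠ 0 := hx
    have h0 : x 0 / R ∈ Function.support f := left_ne_zero_of_mul hx'
    have h1 : x 1 ∈ Function.support g := right_ne_zero_of_mul hx'
    rw [f.support_eq] at h0
    rw [g.support_eq] at h1
    have h0' : |x 0 / R| < 2 := by simpa [f, abs_div] using h0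
    have h1' : |x 1| < 3 := by simpa [g] using h1
    rw [abs_div, abs_of_pos hR1, div_lt_iff₀ hR1] at h0'
    rw [mem_closedBall_zero_iff]
    apply le_of_sq_le_sq _ (by positivity)
    rw [EuclideanSpace.norm_sq_eq]
    simp only [Fin.sum_univ_two, Real.norm_eq_abs]
    nlinarith [abs_nonneg (x 0), abs_nonneg (x 1)]
  · have hL : (∫ x in {x : R2 | -1 < x 1 ∧ x 1 < 1},
        ‖grad (fun x : R2 => f (x 0 / R) * g (x 1)) x‖ ^ 2)
        = 2 * (R * ((∫ t : ℝ, (deriv f t) ^ 2) / R ^ 2)) := by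
      have hms : MeasurableSet {x : R2 | -1 < x 1 ∧ x 1 < 1} := by
        apply IsOpen.measurableSet
        apply IsOpen.and <;> apply isOpen_lt <;> fun_prop
      rw [setIntegral_congr_fun hms (g := fun x => (fun t => (deriv f (t / R) / R) ^ 2) (x 0)),
        strip_integral (fun t => (deriv f (t / R) / R) ^ 2),
        Measure.integral_comp_div (fun t => (deriv f t / R) ^ 2) R]
      · simp only [div_pow, integral_div, abs_of_pos hR1, smul_eq_mul]
      · intro x hx
        exact grad_eta f g f.contDiff R x
          (hg1 _ (by rw [abs_lt]; constructor <;> linarith [hx.1, hx.2]))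
    have hb : ∀ c : ℝ, |c| < 2 → (∫ t : ℝ, ((fun x : R2 => f (x 0 / R) * g (x 1))
        (t • e 0 + c • e 1)) ^ 2) = R * ∫ t : ℝ, (f t) ^ 2 := by
      intro c hc
      have hgc : g c = 1 := (hg1 c hc).eq_of_nhds
      have := Measure.integral_comp_div (fun t => (f t) ^ 2) R
      rw [abs_of_pos hR1, smul_eq_mul] at this
      rw [← this]
      simp [e, hgc]
    rw [hL, hb 1 (by norm_num), hb (-1) (by norm_num)]
    have : (∫ t : ℝ, (deriv f t) ^ 2) / R ^ 2 < ∫ t : ℝ, (f t) ^ 2 := by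
      rw [div_lt_iff₀ (by positivity)]; linarith
    nlinarith [mul_lt_mul_of_pos_left this hR1]
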